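/- Σ_{n=1}^∞ ((3n+1)/(2n+1)²) · (16ⁿ / (n³·C(2n,n)³)) = π²/2 − 4, where C(2n,n) denotes the central binomial coefficient. -/

import Mathlib

open Filter Topology Finset

/-- The rising factorial `x (x+1) ⋯ (x+n)`. -/
noncomputable def risingProd (n : ℕ) (x : ℝ) : ℝ := ∏ i ∈ range (n + 1), (x + i)

/-- The WZ mate `n!⁴ / ((2n)! (x)ₙ₊₁²)`. -/
noncomputable def wzF (n : ℕ) (x : ℝ) : ℝ :=
  (n.factorial : ℝ) ^ 4 / ((2 * n).factorial * risingProd n x ^ 2)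

/-- The summand of an accelerated series for the Hurwitz zeta value `∑ 1/(x+j)²`. -/
noncomputable def wzG (n : ℕ) (x : ℝ) : ℝ :=
  (n.factorial : ℝ) ^ 4 * (x + (3 * n + 1) / 2) / ((2 * n + 1).factorial * risingProd n x ^ 2)

lemma risingProd_pos (n : ℕ) {x : ℝ} (hx : 0 < x) : 0 < risingProd n x :=
  prod_pos fun i _ => by positivity

lemma risingProd_succ (n : ℕ) (x : ℝ) :
    risingProd (n + 1) x = risingProd n x * (x + n + 1) := by
  unfold risingProd
  rw [prod_range_succ _ (n + 1)]
  push_cast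
  ring

lemma risingProd_add_one_mul (n : ℕ) (x : ℝ) :
    risingProd n (x + 1) * x = risingProd n x * (x + n + 1) := by
  rw [← risingProd_succ]
  unfold risingProd
  rw [prod_range_succ' _ (n + 1)]
  push_cast
  simp only [add_zero, add_assoc, add_comm (1 : ℝ)]

lemma mul_factorial_le_risingProd (n : ℕ) {x : ℝ} (hx : 0 < x) :
    x * n.factorial ≤ risingProd n x := by
  induction n with
  | zero => simp [risingProd]
  | succ n ih =>
    rw [risingProd_succ, Nat.factorial_succ]
    push_cast
    have h := mul_le_mul ih (by linarith : (n : ℝ) + 1 ≤ x + n + 1) (by positivity)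
      (risingProd_pos n hx).le
    linarith

lemma wzG_sub_wzG (n : ℕ) {x : ℝ} (hx : 0 < x) :
    wzG n x - wzG n (x + 1) = wzF n x - wzF (n + 1) x := by
  have hP := (risingProd_pos n hx).ne'
  have hy : x + n + 1 ≠ 0 := by positivity
  have hQ : risingProd n (x + 1) = risingProd n x * (x + n + 1) / x := by
    rw [← risingProd_add_one_mul]
    field_simp
  have h2 : 2 * (n + 1) = 2 * n + 1 + 1 := by ring
  have hf : ((2 * n).factorial : ℝ) ≠ 0 := by positivity
  have hn : (2 * (n : ℝ) + 1) ≠ 0 := by positivity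
  have hn' : ((n : ℝ) + 1) ≠ 0 := by positivity
  have hn'' : (2 * (n : ℝ) + 1 + 1) ≠ 0 := by positivity
  unfold wzG wzF
  rw [hQ, risingProd_succ, h2]
  simp only [Nat.factorial_succ]
  push_cast
  field_simp
  ring

lemma wzF_nonneg (n : ℕ) (x : ℝ) : 0 ≤ wzF n x := by
  unfold wzF; positivity

lemma wzG_nonneg (n : ℕ) {x : ℝ} (hx : 0 < x) : 0 ≤ wzG n x := by
  unfold wzG; positivity

lemma wzF_zero (x : ℝ) : wzF 0 x = 1 / x ^ 2 := by
  simp [wzF, risingProd]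

lemma wzF_le (n : ℕ) {x : ℝ} (hx : 0 < x) :
    wzF n x ≤ 1 / n.centralBinom * (1 / x ^ 2) := by
  have hc : (n.centralBinom : ℝ) * (n.factorial * n.factorial) = (2 * n).factorial := by
    have h := Nat.choose_mul_factorial_mul_factorial (n := 2 * n) (k := n) (by omega)
    rw [show 2 * n - n = n by omega] at h
    rw [Nat.centralBinom, ← h]
    push_cast
    ring
  have hc0 : (0 : ℝ) < n.centralBinom := by exact_mod_cast n.centralBinom_pos
  calc wzF n x ≤ (n.factorial : ℝ) ^ 4 / ((2 * n).factorial * (x * n.factorial) ^ 2) := by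
        unfold wzF
        gcongr
        exact mul_factorial_le_risingProd n hx
    _ = 1 / n.centralBinom * (1 / x ^ 2) := by
        rw [← hc]
        have : (n.factorial : ℝ) ≠ 0 := by positivity
        field_simp

lemma wzG_le (n : ℕ) {x : ℝ} (hx : 0 < x) :
    wzG n x ≤ (n.factorial : ℝ) ^ 2 * (1 / x + (3 * n + 1) / 2 * (1 / x ^ 2)) := by
  have hf : (1 : ℝ) ≤ (2 * n + 1).factorial := by
    exact_mod_cast (2 * n + 1).factorial_pos
  calc wzG n x ≤ (n.factorial : ℝ) ^ 4 * (x + (3 * n + 1) / 2) / (1 * (x * n.factorial) ^ 2) := by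
        unfold wzG
        gcongr
        exact mul_factorial_le_risingProd n hx
    _ = _ := by
        have : (n.factorial : ℝ) ≠ 0 := by positivity
        field_simp

lemma tendsto_wzG_shift (n : ℕ) {x : ℝ} (hx : 0 < x) :
    Tendsto (fun j : ℕ => wzG n (x + j)) atTop (𝓝 0) := by
  have h1 : Tendsto (fun j : ℕ => x + (j : ℝ)) atTop atTop :=
    tendsto_atTop_add_const_left _ _ tendsto_natCast_atTop_atTop
  have h2 : Tendsto (fun j : ℕ => 1 / (x + (j : ℝ))) atTop (𝓝 0) := by
    simp_rw [one_div]
    exact h1.inv_tendsto_atTop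
  have h3 := (h2.add ((h2.pow 2).const_mul ((3 * (n : ℝ) + 1) / 2))).const_mul
    ((n.factorial : ℝ) ^ 2)
  refine squeeze_zero (fun j => wzG_nonneg n (by positivity))
    (fun j => wzG_le n (by positivity)) ?_
  simpa using h3

lemma sum_wzG_sub_sum_wzG (N J : ℕ) {x : ℝ} (hx : 0 < x) :
    ∑ n ∈ range N, wzG n x - ∑ n ∈ range N, wzG n (x + J) =
      ∑ j ∈ range J, (wzF 0 (x + j) - wzF N (x + j)) := by
  induction J with
  | zero => simp
  | succ J ih =>
    have h : ∑ n ∈ range N, (wzG n (x + J) - wzG n (x + J + 1)) =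
        wzF 0 (x + J) - wzF N (x + J) := by
      rw [sum_congr rfl fun n _ => wzG_sub_wzG n (by positivity : 0 < x + J),
        sum_range_sub' (fun n => wzF n (x + J))]
    rw [sum_range_succ, ← ih, ← h, sum_sub_distrib]
    push_cast
    rw [add_assoc]
    ring

lemma hasSum_wzF_sub (N : ℕ) {x : ℝ} (hx : 0 < x) :
    HasSum (fun j : ℕ => wzF 0 (x + j) - wzF N (x + j)) (∑ n ∈ range N, wzG n x) := by
  have hc : (1 : ℝ) ≤ N.centralBinom := by exact_mod_cast N.centralBinom_pos
  rw [hasSum_iff_tendsto_nat_of_nonneg]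
  · simp_rw [← sum_wzG_sub_sum_wzG N _ hx]
    simpa using (tendsto_finsetSum (range N) fun n _ => tendsto_wzG_shift n hx).const_sub
      (∑ n ∈ range N, wzG n x)
  · intro j
    have hj : 0 < x + j := by positivity
    rw [sub_nonneg, wzF_zero]
    refine (wzF_le N hj).trans (mul_le_of_le_one_left (by positivity) ?_)
    rw [div_le_one (by positivity)]
    exact hc

/-- The accelerated series sums to the Hurwitz zeta value at `2`. -/
lemma hasSum_wzG {x s : ℝ} (hx : 0 < x) (hs : HasSum (fun j : ℕ => 1 / (x + j) ^ 2) s) :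
    HasSum (fun n => wzG n x) s := by
  rw [hasSum_iff_tendsto_nat_of_nonneg fun n => wzG_nonneg n hx]
  have hcb : Tendsto (fun N : ℕ => 1 / (N.centralBinom : ℝ)) atTop (𝓝 0) := by
    refine squeeze_zero (fun N => by positivity) (fun N => ?_)
      (tendsto_one_div_add_atTop_nhds_zero_nat (𝕜 := ℝ))
    have h : N + 1 ≤ N.centralBinom := by
      rcases N.eq_zero_or_pos with rfl | hN
      · simp
      · have := Nat.choose_le_centralBinom 1 N
        rw [Nat.choose_one_right] at this
        omega
    gcongr
    exact_mod_cast h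
  have hlow : Tendsto (fun N : ℕ => s - 1 / (N.centralBinom : ℝ) * s) atTop (𝓝 s) := by
    simpa using (hcb.mul_const s).const_sub s
  refine tendsto_of_tendsto_of_tendsto_of_le_of_le hlow tendsto_const_nhds
    (fun N => ?_) (fun N => ?_)
  · refine hasSum_le (fun j => ?_) (hs.sub (hs.mul_left _)) (hasSum_wzF_sub N hx)
    have := wzF_le N (x := x + j) (by positivity)
    rw [wzF_zero]
    linarith
  · refine hasSum_le (fun j => ?_) (hasSum_wzF_sub N hx) hs
    rw [wzF_zero]
    linarith [wzF_nonneg N (x + j)]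

lemma hasSum_one_div_half_add_sq :
    HasSum (fun j : ℕ => 1 / ((1 / 2 : ℝ) + j) ^ 2) (Real.pi ^ 2 / 2) := by
  have h : HasSum (fun n : ℕ => 1 / (n : ℝ) ^ 2) (Real.pi ^ 2 / 6) := hasSum_zeta_two
  have he : HasSum (fun k : ℕ => 1 / ((2 * k : ℕ) : ℝ) ^ 2) (1 / 4 * (Real.pi ^ 2 / 6)) := by
    have hfun : (fun k : ℕ => 1 / ((2 * k : ℕ) : ℝ) ^ 2) =
        fun k : ℕ => 1 / 4 * (1 / (k : ℝ) ^ 2) := by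
      funext k
      rw [one_div_mul_one_div]
      push_cast
      congr 1
      ring
    rw [hfun]
    exact h.mul_left (1 / 4)
  have ho : Summable (fun k : ℕ => 1 / ((2 * k + 1 : ℕ) : ℝ) ^ 2) :=
    h.summable.comp_injective (i := fun k : ℕ => 2 * k + 1) fun a b hab => by
      simpa using hab
  have hsum := (HasSum.even_add_odd (f := fun n : ℕ => 1 / (n : ℝ) ^ 2) he ho.hasSum).unique h
  have h4 := ho.hasSum.mul_left 4
  rw [show 4 * ∑' k : ℕ, 1 / ((2 * k + 1 : ℕ) : ℝ) ^ 2 = Real.pi ^ 2 / 2 by linarith] at h4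
  have hfun : (fun j : ℕ => 1 / ((1 / 2 : ℝ) + j) ^ 2) =
      fun k : ℕ => 4 * (1 / ((2 * k + 1 : ℕ) : ℝ) ^ 2) := by
    funext j
    have hj : (2 * (j : ℝ) + 1) ≠ 0 := by positivity
    rw [show (1 / 2 : ℝ) + j = (2 * j + 1) / 2 by ring]
    push_cast
    field_simp
    norm_num
  rwa [hfun]

/-- `16ⁿ⁺¹ / ((n+1) C(2n+2,n+1))³`. -/
noncomputable def cubeTerm (n : ℕ) : ℝ :=
  16 ^ (n + 1) / (((n : ℝ) + 1) ^ 3 * ((2 * (n + 1)).choose (n + 1) : ℝ) ^ 3)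

lemma cubeTerm_succ (n : ℕ) :
    cubeTerm (n + 1) = cubeTerm n * (2 * (n + 1) ^ 3 / (2 * n + 3) ^ 3) := by
  have hc : ((n : ℝ) + 2) * (2 * (n + 1 + 1)).choose (n + 1 + 1) =
      2 * (2 * n + 3) * (2 * (n + 1)).choose (n + 1) := by
    have h := Nat.succ_mul_centralBinom_succ (n + 1)
    simp only [Nat.centralBinom] at h
    have h' := congrArg (Nat.cast : ℕ → ℝ) h
    push_cast at h' ⊢
    linear_combination h'
  have h0 : ((2 * (n + 1)).choose (n + 1) : ℝ) ≠ 0 := by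
    exact_mod_cast (Nat.centralBinom_pos (n + 1)).ne'
  have h3 : (2 * (n : ℝ) + 3) ≠ 0 := by positivity
  unfold cubeTerm
  push_cast
  rw [show (n : ℝ) + 1 + 1 = n + 2 by ring, ← mul_pow, hc]
  field_simp
  ring

lemma wzG_half (n : ℕ) : wzG n (1 / 2) = (3 * n + 2) * cubeTerm n := by
  suffices h : (n.factorial : ℝ) ^ 4 / ((2 * n + 1).factorial * risingProd n (1 / 2) ^ 2) =
      2 * cubeTerm n by
    unfold wzG
    rw [mul_div_right_comm, h]
    ring
  induction n with
  | zero => simp [risingProd, cubeTerm]; norm_num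
  | succ n ih =>
    have hP := (risingProd_pos n (by norm_num : (0 : ℝ) < 1 / 2)).ne'
    have h3 : (2 * (n : ℝ) + 3) ≠ 0 := by positivity
    have hf : ((2 * n + 1).factorial : ℝ) ≠ 0 := by positivity
    rw [cubeTerm_succ, ← mul_assoc, ← ih, risingProd_succ,
      show 2 * (n + 1) + 1 = 2 * n + 1 + 1 + 1 by ring]
    simp only [Nat.factorial_succ (2 * n + 1 + 1), Nat.factorial_succ (2 * n + 1),
      Nat.factorial_succ n]
    push_cast
    rw [show (1 / 2 : ℝ) + n + 1 = (2 * n + 3) / 2 by ring,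
      show 2 * (n : ℝ) + 1 + 1 + 1 = 2 * n + 3 by ring]
    field_simp
    ring

lemma sum_cubeTerm (N : ℕ) :
    ∑ n ∈ range N, (3 * ((n : ℝ) + 1) + 1) / (2 * ((n : ℝ) + 1) + 1) ^ 2 * cubeTerm n =
      ∑ n ∈ range N, wzG (n + 1) (1 / 2) + N * cubeTerm N := by
  induction N with
  | zero => simp
  | succ N ih =>
    have h3 : (2 * (N : ℝ) + 3) ≠ 0 := by positivity
    rw [sum_range_succ, sum_range_succ, ih, wzG_half, cubeTerm_succ,
      show 2 * ((N : ℝ) + 1) + 1 = 2 * N + 3 by ring]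
    push_cast
    field_simp
    ring

/-- The rational Zeilberger-type series
`Σ_{n≥1} (3n+1)/(2n+1)² · 16ⁿ/(n³·C(2n,n)³) = π²/2 − 4`. -/
theorem stmt_11 :
    ∑' n : ℕ,
      (3 * ((n : ℝ) + 1) + 1) / (2 * ((n : ℝ) + 1) + 1) ^ 2 *
        (16 ^ (n + 1) / (((n : ℝ) + 1) ^ 3 * ((2 * (n + 1)).choose (n + 1) : ℝ) ^ 3)) =
      Real.pi ^ 2 / 2 - 4 := by
  have hG := hasSum_wzG (by norm_num : (0 : ℝ) < 1 / 2) hasSum_one_div_half_add_sq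
  have hpos : ∀ n, 0 ≤ cubeTerm n := fun n => by unfold cubeTerm; positivity
  have hlim : Tendsto (fun N : ℕ => N * cubeTerm N) atTop (𝓝 0) := by
    refine squeeze_zero (fun N => mul_nonneg N.cast_nonneg (hpos N)) (fun N => ?_)
      hG.summable.tendsto_atTop_zero
    rw [wzG_half]
    exact mul_le_mul_of_nonneg_right (by linarith [N.cast_nonneg (α := ℝ)]) (hpos N)
  have hG1 : Tendsto (fun N => ∑ n ∈ range N, wzG (n + 1) (1 / 2)) atTop
      (𝓝 (Real.pi ^ 2 / 2 - 4)) := by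
    have h := ((hasSum_nat_add_iff' 1).2 hG).tendsto_sum_nat
    rwa [sum_range_one, show wzG 0 (1 / 2) = 4 by simp [wzG, risingProd]; norm_num] at h
  refine HasSum.tsum_eq ?_
  rw [hasSum_iff_tendsto_nat_of_nonneg fun n => by positivity]
  have h := hG1.add hlim
  rw [add_zero] at h
  exact h.congr fun N => (sum_cubeTerm N).symm
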